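/- Let c > 0 and 0 < λ < a. Let h : ℝ → ℝ be continuously differentiable and satisfy: (i) h(a) = c·a; (ii) h(λ) < c·λ; (iii) h'(λ) > c; (iv) h(t) ≥ h(λ) + h'(λ)(t − λ) for all t ∈ [λ, a]; (v) 2(cλ − h(λ))/(h'(λ) − c) > a − λ. Define ĥ(s) = h(s) for s ≤ a and ĥ(s) = c·s for s > a. Then there exist real numbers t₀, t₁ with 0 < t₀ < a < t₁ and a continuously differentiable function η̃ : ℝ → ℝ such that: η̃(s) ≤ ĥ(s) for all s ∈ [t₀, t₁]; η̃(t₀) = h(t₀) and η̃(t₁) = c·t₁; η̃'(t₀) = h'(t₀) and η̃'(t₁) = c; and the map s ↦ η̃(s)/s is nondecreasing on [t₀, t₁]. -/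

import Mathlib

/-- Key lemma of Appendix A: given `h` crossing the line `c·s` from below at `a`
(with the quantitative hypotheses (i)-(v)), there are `t₀ < a < t₁` and a `C¹`
function `η̃` with `η̃ ≤ ĥ` on `[t₀, t₁]`, matching `ĥ` in value and derivative at
both endpoints, and such that `s ↦ η̃(s)/s` is nondecreasing on `[t₀, t₁]`. -/
theorem stmt_4 (c a lam : ℝ) (hc : 0 < c) (hlam : 0 < lam) (hla : lam < a)
    (h : ℝ → ℝ) (hC1 : ContDiff ℝ 1 h)
    (h1 : h a = c * a) (h2 : h lam < c * lam) (h3 : deriv h lam > c)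
    (h4 : ∀ t ∈ Set.Icc lam a, h t ≥ h lam + deriv h lam * (t - lam))
    (h5 : 2 * (c * lam - h lam) / (deriv h lam - c) > a - lam)
    (hhat : ℝ → ℝ) (hhat_def : ∀ s, hhat s = if s ≤ a then h s else c * s) :
    ∃ t₀ t₁ : ℝ, ∃ η : ℝ → ℝ,
      0 < t₀ ∧ t₀ < a ∧ a < t₁ ∧ ContDiff ℝ 1 η ∧
      (∀ s ∈ Set.Icc t₀ t₁, η s ≤ hhat s) ∧
      η t₀ = h t₀ ∧ η t₁ = c * t₁ ∧
      deriv η t₀ = deriv h t₀ ∧ deriv η t₁ = c ∧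
      MonotoneOn (fun s => η s / s) (Set.Icc t₀ t₁) := by
  have hm : 0 < deriv h lam - c := by linarith
  have hD : 0 < c * lam - h lam := by linarith
  obtain ⟨T, hT⟩ : ∃ T, T = 2 * (c * lam - h lam) / (deriv h lam - c) := ⟨_, rfl⟩
  obtain ⟨B, hB⟩ : ∃ B, B = (deriv h lam - c) / (2 * T) := ⟨_, rfl⟩
  rw [← hT] at h5
  have hTpos : 0 < T := by linarith
  have hBpos : 0 < B := by rw [hB]; positivity
  have e1 : deriv h lam = c + 2 * B * T := by
    rw [hB]; field_simp; ring
  have e2 : h lam = c * lam - B * T ^ 2 := by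
    have : T * (deriv h lam - c) = 2 * (c * lam - h lam) := by
      rw [hT]; field_simp
    rw [e1] at this
    linarith
  have hd : ∀ s, HasDerivAt (fun s : ℝ => c * s - B * (s - (lam + T)) ^ 2)
      (c - 2 * B * (s - (lam + T))) s := by
    intro s
    have := ((hasDerivAt_id s).const_mul c).sub
      ((((hasDerivAt_id s).sub_const (lam + T)).pow 2).const_mul B)
    refine this.congr_deriv ?_
    simp
    ring
  refine ⟨lam, lam + T, fun s => c * s - B * (s - (lam + T)) ^ 2, hlam, hla, by linarith,
    by fun_prop, ?_, ?_, ?_, ?_, ?_, ?_⟩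
  · rintro s ⟨hs1, hs2⟩
    rw [hhat_def]
    split_ifs with hs
    · have h6 := h4 s ⟨hs1, hs⟩
      rw [e1, e2] at h6
      have h7 : 0 ≤ B * (s - lam) ^ 2 := by positivity
      simp only
      nlinarith
    · have h7 : 0 ≤ B * (s - (lam + T)) ^ 2 := by positivity
      simp only
      linarith
  · simp only
    rw [e2]; ring
  · simp
  · rw [(hd lam).deriv, e1]; ring
  · rw [(hd (lam + T)).deriv]; ring
  · rintro x ⟨hx1, hx2⟩ y ⟨hy1, hy2⟩ hxy
    have hx : 0 < x := by linarith
    have hy : 0 < y := by linarith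
    simp only
    rw [div_le_div_iff₀ hx hy]
    have h8 : 0 ≤ B * ((y - x) * ((lam + T) ^ 2 - x * y)) := by
      have : x * y ≤ (lam + T) ^ 2 := by nlinarith
      exact mul_nonneg hBpos.le (mul_nonneg (by linarith) (by linarith))
    nlinarith
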